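/- arXiv:1903.05272 — 11 statements merged into one kernel-verified Lean document; each statement's English description precedes it below -/
import Mathlib

section
/- Let Y be the n×n matrix over R whose rows are indexed by k = 0,1,…,n−1, the k-th row being the vector T^k v. Then there exists a nonzero constant c ∈ ℂ such that det Y = c · ∏_{1≤i<j≤n} (x_i + x_j). -/
open MvPolynomial Matrix

noncomputable section

/-- The matrix `T` over `ℂ[x₁,…,xₙ]` with `T i j = x j` for `i < j`, `-x j` for `i > j`,
and `0` on the diagonal. -/
def Tmat (n : ℕ) : Matrix (Fin n) (Fin n) (MvPolynomial (Fin n) ℂ) :=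
  Matrix.of fun i j => if i < j then X j else if j < i then -X j else 0

/-- The matrix `Y` whose `k`-th row is the vector `T^k v`, where `v` is the all-ones vector. -/
def Ymat (n : ℕ) : Matrix (Fin n) (Fin n) (MvPolynomial (Fin n) ℂ) :=
  Matrix.of fun k i => ((Tmat n ^ (k : ℕ)).mulVec (fun _ => 1)) i

/-- If `b` is obtained from `v` by the descending recursion `b k = T b (k + 1) + p (k + 1) v`,
then the matrix of the `b k` has the same determinant as the Krylov matrix of `v`. -/
theorem det_krylov_eq_det_of_recursion {R : Type*} [CommRing R] {n : ℕ}
    (T : Matrix (Fin n) (Fin n) R) (v : Fin n → R) (b : ℕ → Fin n → R) (p : ℕ → R)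
    (hb : b (n - 1) = v) (hrec : ∀ k, k + 1 < n → b k = T *ᵥ b (k + 1) + p (k + 1) • v) :
    (Matrix.of fun (k : Fin n) i => (T ^ (k : ℕ) *ᵥ v) i).det =
      (Matrix.of fun (k : Fin n) i => b (n - 1 - k) i).det := by
  have key : ∀ j, j < n → b (n - 1 - j) =
      T ^ j *ᵥ v + ∑ l ∈ Finset.range j, p (n - j + l) • (T ^ l *ᵥ v) := by
    intro j
    induction j with
    | zero => intro _; simp [hb]
    | succ j ih =>
      intro hj
      have h1 : n - 1 - (j + 1) + 1 = n - 1 - j := by omega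
      rw [hrec _ (by omega), h1, ih (by omega), Matrix.mulVec_add, Finset.sum_range_succ',
        Matrix.mulVec_sum, Matrix.mulVec_mulVec, ← pow_succ', add_assoc]
      congr 2
      · refine Finset.sum_congr rfl fun l _ => ?_
        rw [Matrix.mulVec_smul, Matrix.mulVec_mulVec, ← pow_succ']
        congr 2
        omega
      · simp only [pow_zero, Matrix.one_mulVec, add_zero]
        congr 2
        omega
  let L : Matrix (Fin n) (Fin n) R := Matrix.of fun j l =>
    if l = j then 1 else if l < j then p (n - j + l) else 0
  have hL : L.det = 1 := by
    rw [Matrix.det_of_isLowerTriangular L]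
    · simp [L]
    · intro i j hij
      have hij : i < j := hij
      simp [L, hij.ne', hij.not_gt]
  have hmul : (Matrix.of fun (k : Fin n) i => b (n - 1 - k) i) =
      L * (Matrix.of fun (k : Fin n) i => (T ^ (k : ℕ) *ᵥ v) i) := by
    ext j i
    rw [Matrix.of_apply, key j j.2, Matrix.mul_apply]
    have h2 : ∀ l : Fin n, L j l * (Matrix.of fun (k : Fin n) i => (T ^ (k : ℕ) *ᵥ v) i) l i =
        (fun l : ℕ => (if l = (j : ℕ) then (T ^ (j : ℕ) *ᵥ v) i else 0) +
          if l < j then p (n - j + l) * (T ^ l *ᵥ v) i else 0) l := by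
      intro l
      simp only [L, Matrix.of_apply, Fin.ext_iff, Fin.lt_def]
      split_ifs with h h' <;> first | omega | simp [h]
    rw [Finset.sum_congr rfl fun l _ => h2 l, Fin.sum_univ_eq_sum_range (fun l =>
      (if l = (j : ℕ) then (T ^ (j : ℕ) *ᵥ v) i else 0) +
        if l < j then p (n - j + l) * (T ^ l *ᵥ v) i else 0) n, Finset.sum_add_distrib,
      Finset.sum_ite_eq', if_pos (Finset.mem_range.2 j.2), ← Finset.sum_filter]
    have h3 : (Finset.range n).filter (· < (j : ℕ)) = Finset.range j := by
      ext l
      simp only [Finset.mem_filter, Finset.mem_range]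
      omega
    rw [h3]
    simp
  rw [hmul, Matrix.det_mul, hL, one_mul]

theorem sum_range_sign_mul_sub {A : Type*} [AddCommGroup A] (f : ℕ → A) {i n : ℕ} (h : i < n) :
    (∑ j ∈ Finset.range n, if i < j then f j - f (j + 1)
      else if j < i then -(f j - f (j + 1)) else 0) = f (i + 1) - f n - (f 0 - f i) := by
  induction n, h using Nat.le_induction with
  | base =>
    rw [Finset.sum_range_succ, ← Finset.sum_range_sub' f i]
    simp only [lt_irrefl, if_false, add_zero, sub_self, zero_sub, ← Finset.sum_neg_distrib]
    refine Finset.sum_congr rfl fun j hj => ?_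
    have := Finset.mem_range.1 hj
    rw [if_neg (by omega), if_pos this]
  | succ n hn ih =>
    rw [Finset.sum_range_succ, ih, if_pos (by omega)]
    abel

section Resolvent

variable {R : Type*} [CommRing R] {n : ℕ} (x : Fin n → R)

/-- The numerator of the `i`-th entry of `(λ - T)⁻¹ v`. -/
def resolventNum (i : Fin n) : Polynomial R :=
  ∏ l ∈ Finset.univ.erase i,
    if l < i then Polynomial.X - Polynomial.C (x l) else Polynomial.X + Polynomial.C (x l)

/-- The product of `λ - x l` over `l < k` and of `λ + x l` over `l ≥ k`. -/
def signedProd (k : ℕ) : Polynomial R :=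
  ∏ l : Fin n,
    if (l : ℕ) < k then Polynomial.X - Polynomial.C (x l) else Polynomial.X + Polynomial.C (x l)

theorem signedProd_eq (i : Fin n) :
    signedProd x i = (Polynomial.X + Polynomial.C (x i)) * resolventNum x i := by
  rw [signedProd, resolventNum, ← Finset.mul_prod_erase _ _ (Finset.mem_univ i)]
  simp

theorem signedProd_succ_eq (i : Fin n) :
    signedProd x (i + 1) = (Polynomial.X - Polynomial.C (x i)) * resolventNum x i := by
  rw [signedProd, resolventNum, ← Finset.mul_prod_erase _ _ (Finset.mem_univ i),
    if_pos (Nat.lt_succ_self _)]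
  congr 1
  refine Finset.prod_congr rfl fun l hl => ?_
  have : (l : ℕ) ≠ i := fun h => (Finset.mem_erase.1 hl).1 (Fin.ext h)
  simp only [Fin.lt_def]
  congr 1
  simp only [eq_iff_iff]
  omega

theorem resolventNum_monic (i : Fin n) : (resolventNum x i).Monic := by
  refine Polynomial.monic_prod_of_monic _ _ fun l _ => ?_
  split_ifs
  · exact Polynomial.monic_X_sub_C _
  · exact Polynomial.monic_X_add_C _

theorem natDegree_resolventNum [Nontrivial R] (i : Fin n) :
    (resolventNum x i).natDegree = n - 1 := by
  rw [resolventNum, Polynomial.natDegree_prod_of_monic]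
  · rw [Finset.sum_congr rfl (g := fun _ => 1)]
    · simp
    · intro l _
      split_ifs
      · exact Polynomial.natDegree_X_sub_C _
      · exact Polynomial.natDegree_X_add_C _
  · intro l _
    split_ifs
    · exact Polynomial.monic_X_sub_C _
    · exact Polynomial.monic_X_add_C _

/-- Twice the `i`-th entry of `(λ - T) q(λ)` does not depend on `i`. -/
theorem two_mul_resolventNum_sub_sum (i : Fin n) :
    2 * (Polynomial.X * resolventNum x i - ∑ j, Polynomial.C (if i < j then x j else
      if j < i then -x j else 0) * resolventNum x j) = signedProd x 0 + signedProd x n := by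
  have hs := sum_range_sign_mul_sub (signedProd x) i.2
  rw [← Fin.sum_univ_eq_sum_range (fun j => if (i : ℕ) < j then
    signedProd x j - signedProd x (j + 1) else if j < (i : ℕ) then
      -(signedProd x j - signedProd x (j + 1)) else 0) n] at hs
  have ht : 2 * ∑ j, Polynomial.C (if i < j then x j else if j < i then -x j else 0) *
      resolventNum x j =
        signedProd x (i + 1) - signedProd x n - (signedProd x 0 - signedProd x i) := by
    rw [← hs, Finset.mul_sum]
    refine Finset.sum_congr rfl fun j _ => ?_
    simp only [signedProd_eq, signedProd_succ_eq, Fin.lt_def]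
    split_ifs <;> (try simp only [map_neg, map_zero]) <;> ring
  rw [mul_sub, ht, signedProd_eq, signedProd_succ_eq]
  ring

theorem eval_resolventNum_of_lt {m i : Fin n} (h : m < i) :
    (resolventNum x i).eval (x m) = 0 := by
  rw [resolventNum, Polynomial.eval_prod]
  refine Finset.prod_eq_zero (Finset.mem_erase.2 ⟨h.ne, Finset.mem_univ m⟩) ?_
  simp [h]

theorem eval_resolventNum_self (i : Fin n) :
    (resolventNum x i).eval (x i) =
      (∏ l with l < i, (x i - x l)) * ∏ l with i < l, (x i + x l) := by
  rw [resolventNum, Polynomial.eval_prod]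
  have : (Finset.univ.erase i : Finset (Fin n)) =
      (Finset.univ.filter (· < i)).disjUnion (Finset.univ.filter (i < ·))
        (Finset.disjoint_filter.2 fun l _ h => h.not_gt) := by
    ext l
    simp
  rw [this, Finset.prod_disjUnion]
  congr 1
  · refine Finset.prod_congr rfl fun l hl => ?_
    simp [(Finset.mem_filter.1 hl).2]
  · refine Finset.prod_congr rfl fun l hl => ?_
    simp [(Finset.mem_filter.1 hl).2.not_gt]

theorem prod_prod_filter_lt {M : Type*} [CommMonoid M] (f : Fin n → Fin n → M) :
    ∏ i, ∏ j with i < j, f i j =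
      ∏ p ∈ Finset.univ.filter (fun p : Fin n × Fin n => p.1 < p.2), f p.1 p.2 := by
  simp only [Finset.prod_filter, Fintype.prod_prod_type]

theorem prod_prod_filter_gt {M : Type*} [CommMonoid M] (f : Fin n → Fin n → M) :
    ∏ i, ∏ j with j < i, f i j =
      ∏ p ∈ Finset.univ.filter (fun p : Fin n × Fin n => p.1 < p.2), f p.2 p.1 := by
  rw [← prod_prod_filter_lt fun i j => f j i]
  simp only [Finset.prod_filter]
  exact Finset.prod_comm

theorem det_coeff_resolventNum [IsDomain R] (hx : Function.Injective x) :
    (Matrix.of fun k i : Fin n => (resolventNum x i).coeff (n - 1 - k)).det =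
      (∏ _p ∈ Finset.univ.filter (fun p : Fin n × Fin n => p.1 < p.2), (-1)) *
        ∏ p ∈ Finset.univ.filter (fun p : Fin n × Fin n => p.1 < p.2), (x p.1 + x p.2) := by
  set B := Matrix.of fun k i : Fin n => (resolventNum x i).coeff (n - 1 - k) with hB
  have hmul : Matrix.projVandermonde (fun _ => 1) x * B =
      Matrix.of fun m i => (resolventNum x i).eval (x m) := by
    ext m i
    have hn : n - 1 + 1 = n := by have := m.2; omega
    rw [Matrix.mul_apply, Matrix.of_apply, Polynomial.eval_eq_sum_range, natDegree_resolventNum,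
      hn, ← Fin.sum_univ_eq_sum_range (fun k => (resolventNum x i).coeff k * x m ^ k),
      ← Equiv.sum_comp Fin.revPerm]
    refine Finset.sum_congr rfl fun k _ => ?_
    have hk : n - (k + 1) = n - 1 - k := by omega
    have hk' : n - 1 - (n - 1 - k) = (k : ℕ) := by omega
    simp [Matrix.projVandermonde_apply, hB, Fin.val_rev, hk, hk', mul_comm]
  have hdet := congrArg Matrix.det hmul
  have hV : ∏ i : Fin n, ∏ j ∈ Finset.Ioi i, ((1 : R) * x i - 1 * x j) =
      ∏ p ∈ Finset.univ.filter (fun p : Fin n × Fin n => p.1 < p.2), (x p.1 - x p.2) := by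
    rw [← prod_prod_filter_lt fun i j => x i - x j]
    simp [Finset.filter_lt_eq_Ioi]
  have hne : ∏ p ∈ Finset.univ.filter (fun p : Fin n × Fin n => p.1 < p.2),
      (x p.1 - x p.2) ≠ 0 :=
    Finset.prod_ne_zero_iff.2 fun p hp =>
      sub_ne_zero.2 fun h => (Finset.mem_filter.1 hp).2.ne (hx h)
  rw [Matrix.det_mul, Matrix.det_projVandermonde, hV,
    Matrix.det_of_isLowerTriangular (Matrix.of fun m i => (resolventNum x i).eval (x m))] at hdet
  · refine mul_left_cancel₀ hne (hdet.trans ?_)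
    simp only [Matrix.of_apply, eval_resolventNum_self, Finset.prod_mul_distrib]
    rw [prod_prod_filter_lt fun i j => x i + x j, prod_prod_filter_gt fun i j => x i - x j,
      ← mul_assoc]
    refine congrArg (· * _) ?_
    rw [← Finset.prod_mul_distrib]
    refine Finset.prod_congr rfl fun p _ => ?_
    ring
  · intro i j hij
    exact eval_resolventNum_of_lt x hij

end Resolvent

theorem det_Ymat (n : ℕ) (hn : 0 < n) :
    ∃ c : ℂ, c ≠ 0 ∧
      (Ymat n).det = MvPolynomial.C c *
        ∏ p ∈ Finset.univ.filter (fun p : Fin n × Fin n => p.1 < p.2), (X p.1 + X p.2) := by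
  let x : Fin n → MvPolynomial (Fin n) ℂ := X
  let E : Fin n → Polynomial (MvPolynomial (Fin n) ℂ) := fun i =>
    Polynomial.X * resolventNum x i - ∑ j, Polynomial.C (if i < j then x j else
      if j < i then -x j else 0) * resolventNum x j
  have hE : ∀ i, E i = E ⟨0, hn⟩ := fun i =>
    mul_left_cancel₀ (two_ne_zero) ((two_mul_resolventNum_sub_sum x i).trans
      (two_mul_resolventNum_sub_sum x ⟨0, hn⟩).symm)
  refine ⟨∏ _p ∈ Finset.univ.filter (fun p : Fin n × Fin n => p.1 < p.2), (-1),
    Finset.prod_ne_zero_iff.2 fun _ _ => by simp, ?_⟩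
  rw [map_prod, map_neg, map_one]
  refine Eq.trans ?_ (det_coeff_resolventNum x (X_injective (R := ℂ)))
  refine det_krylov_eq_det_of_recursion (Tmat n) (fun _ => 1)
    (fun k i => (resolventNum x i).coeff k) (fun k => (E ⟨0, hn⟩).coeff k) ?_ ?_
  · funext i
    rw [← natDegree_resolventNum x i]
    exact resolventNum_monic x i
  · intro k _
    funext i
    have h := congrArg (fun q => Polynomial.coeff q (k + 1)) (hE i)
    simp only [E, Polynomial.coeff_sub, Polynomial.coeff_X_mul, Polynomial.finsetSum_coeff,
      Polynomial.coeff_C_mul] at h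
    simp only [Pi.add_apply, Pi.smul_apply, smul_eq_mul, mul_one, E, Polynomial.coeff_sub,
      Polynomial.coeff_X_mul, Polynomial.finsetSum_coeff, Polynomial.coeff_C_mul, ← h,
      Matrix.mulVec, dotProduct, Tmat, Matrix.of_apply]
    exact (add_sub_cancel _ _).symm
end
end

section
/- For all i, j ≥ 0, the polynomial (T^i v)^t · C · (T^j v) ∈ R is a symmetric polynomial, i.e., it is invariant under every permutation of the variables x_1,…,x_n. -/
open MvPolynomial Matrix

noncomputable section

/-- If `u` solves the linear system `u i = a + t * (∑_{j > i} x j * u j - ∑_{j < i} x j * u j)`,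
then the weighted sum of `u` is determined by the products `∏ (1 ± t * x i)`. -/
theorem sub_mul_prod_eq_add_mul_prod {A : Type*} [CommRing A] (t : A) (n : ℕ) (a : A)
    (x u : Fin n → A)
    (h : ∀ i, u i = a + t * ∑ j, (if i < j then x j else if j < i then -x j else 0) * u j) :
    (a - t * ∑ i, x i * u i) * ∏ i, (1 + t * x i) =
      (a + t * ∑ i, x i * u i) * ∏ i, (1 - t * x i) := by
  induction n generalizing a with
  | zero => simp
  | succ n ih =>
    have h0 := h 0
    have hs := ih (a - t * (x 0 * u 0)) (fun i => x i.succ) (fun i => u i.succ) fun i => by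
      have hi := h i.succ
      simp only [Fin.sum_univ_succ, Fin.succ_lt_succ_iff, Fin.not_lt_zero, Fin.succ_pos,
        if_true, if_false] at hi
      linear_combination hi
    simp only [Fin.sum_univ_succ, Fin.prod_univ_succ, Fin.succ_pos, lt_self_iff_false,
      if_true, if_false, zero_mul, zero_add] at h0 ⊢
    linear_combination (1 + t * x 0) * hs - 2 * t * x 0 * (∏ i : Fin n, (1 - t * x i.succ)) * h0

/-- The generating function of the entries `(T ^ k v) i`. -/
def powMulVecSeries (n : ℕ) (i : Fin n) : PowerSeries (MvPolynomial (Fin n) ℂ) :=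
  PowerSeries.mk fun k => (Tmat n ^ k).mulVec (fun _ => 1) i

/-- The generating function of the moments `vᵗ C T ^ k v`. -/
def momentSeries (n : ℕ) : PowerSeries (MvPolynomial (Fin n) ℂ) :=
  ∑ i, PowerSeries.C (X i) * powMulVecSeries n i

theorem coeff_momentSeries (n k : ℕ) :
    PowerSeries.coeff k (momentSeries n) = ∑ i, X i * (Tmat n ^ k).mulVec (fun _ => 1) i := by
  simp [momentSeries, powMulVecSeries]

theorem powMulVecSeries_eq (n : ℕ) (i : Fin n) :
    powMulVecSeries n i = 1 + PowerSeries.X * ∑ j, (if i < j then PowerSeries.C (X j) else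
      if j < i then -PowerSeries.C (X j) else 0) * powMulVecSeries n j := by
  have hT : ∀ j, (if i < j then PowerSeries.C (X j) else
      if j < i then -PowerSeries.C (X j) else 0) = PowerSeries.C (Tmat n i j) := by
    intro j
    simp only [Tmat, Matrix.of_apply]
    split_ifs <;> simp
  simp only [hT]
  ext1 k
  cases k with
  | zero => simp [powMulVecSeries]
  | succ k =>
    rw [map_add, PowerSeries.coeff_succ_X_mul, map_sum]
    simp only [PowerSeries.coeff_C_mul, powMulVecSeries, PowerSeries.coeff_mk, pow_succ',
      ← Matrix.mulVec_mulVec, PowerSeries.coeff_one]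
    simp [Matrix.mulVec, dotProduct]

theorem map_rename_momentSeries (n : ℕ) (e : Equiv.Perm (Fin n)) :
    PowerSeries.map (rename e : MvPolynomial (Fin n) ℂ →ₐ[ℂ] _).toRingHom (momentSeries n) =
      momentSeries n := by
  have key := sub_mul_prod_eq_add_mul_prod PowerSeries.X n 1 (fun i => PowerSeries.C (X i))
    (powMulVecSeries n) (powMulVecSeries_eq n)
  change (1 - PowerSeries.X * momentSeries n) * _ = (1 + PowerSeries.X * momentSeries n) * _ at key
  set f := PowerSeries.map (rename e : MvPolynomial (Fin n) ℂ →ₐ[ℂ] _).toRingHom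
  have key' := congrArg f key
  have hX : f PowerSeries.X = PowerSeries.X := PowerSeries.map_X _
  have hC : ∀ i, f (PowerSeries.C (X i)) = PowerSeries.C (X (e i)) := fun i => by simp [f]
  simp only [map_mul, map_sub, map_add, map_one, map_prod, hX, hC] at key'
  rw [Equiv.prod_comp e fun i => 1 + PowerSeries.X * PowerSeries.C (X i : MvPolynomial (Fin n) ℂ),
    Equiv.prod_comp e fun i => 1 - PowerSeries.X * PowerSeries.C (X i : MvPolynomial (Fin n) ℂ)]
    at key'
  set P := ∏ i, (1 + PowerSeries.X * PowerSeries.C (X i : MvPolynomial (Fin n) ℂ)) with hP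
  set M := ∏ i, (1 - PowerSeries.X * PowerSeries.C (X i : MvPolynomial (Fin n) ℂ)) with hM
  have hne : P + M ≠ 0 := by
    intro h0
    have h1 := congrArg PowerSeries.constantCoeff h0
    simp [hP, hM, map_prod] at h1
  have hX0 : (PowerSeries.X : PowerSeries (MvPolynomial (Fin n) ℂ)) ≠ 0 := PowerSeries.X_ne_zero
  apply mul_left_cancel₀ hX0
  apply mul_right_cancel₀ hne
  linear_combination key - key'

theorem transpose_Tmat_mul_diagonal (n : ℕ) :
    (Tmat n)ᵀ * Matrix.diagonal (fun i : Fin n => (X i : MvPolynomial (Fin n) ℂ)) =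
      Matrix.diagonal (fun i : Fin n => (X i : MvPolynomial (Fin n) ℂ)) * (-Tmat n) := by
  ext1 a b
  rw [Matrix.mul_diagonal, Matrix.diagonal_mul]
  simp only [Tmat, Matrix.transpose_apply, Matrix.of_apply, Matrix.neg_apply]
  rcases lt_trichotomy a b with h | h | h
  · simp [h, h.not_gt, mul_comm]
  · simp [h]
  · simp [h, h.not_gt]

theorem gram_entry_eq (n i j : ℕ) :
    dotProduct ((Tmat n ^ i).mulVec (fun _ => 1))
        ((Matrix.diagonal fun i : Fin n => (X i : MvPolynomial (Fin n) ℂ)).mulVec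
          ((Tmat n ^ j).mulVec (fun _ => 1))) =
      (-1) ^ i * PowerSeries.coeff (i + j) (momentSeries n) := by
  have hpow : (Tmat n ^ i)ᵀ * Matrix.diagonal (fun i : Fin n => (X i : MvPolynomial (Fin n) ℂ)) =
      Matrix.diagonal (fun i : Fin n => (X i : MvPolynomial (Fin n) ℂ)) * (-Tmat n) ^ i := by
    rw [Matrix.transpose_pow]
    exact (SemiconjBy.pow_right (transpose_Tmat_mul_diagonal n).symm i).symm
  rw [← Matrix.vecMul_transpose, ← Matrix.dotProduct_mulVec, Matrix.mulVec_mulVec, hpow,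
    ← Matrix.mulVec_mulVec, Matrix.mulVec_mulVec _ ((-Tmat n) ^ i), coeff_momentSeries]
  have hsign : (-Tmat n) ^ i * Tmat n ^ j =
      ((-1 : MvPolynomial (Fin n) ℂ) ^ i) • Tmat n ^ (i + j) := by
    rw [← neg_one_smul (MvPolynomial (Fin n) ℂ) (Tmat n), smul_pow, smul_mul_assoc, pow_add]
  rw [hsign, Matrix.smul_mulVec, Matrix.mulVec_smul, dotProduct_smul, smul_eq_mul]
  simp [dotProduct, Matrix.mulVec_diagonal]

theorem gram_entries_symmetric (n : ℕ) (i j : ℕ) :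
    MvPolynomial.IsSymmetric
      (dotProduct ((Tmat n ^ i).mulVec (fun _ => 1))
        ((Matrix.diagonal fun i : Fin n => (X i : MvPolynomial (Fin n) ℂ)).mulVec
          ((Tmat n ^ j).mulVec (fun _ => 1)))) := by
  intro e
  rw [gram_entry_eq]
  have h := congrArg (PowerSeries.coeff (i + j)) (map_rename_momentSeries n e)
  rw [PowerSeries.coeff_map] at h
  rw [map_mul, map_pow, map_neg, map_one]
  exact congrArg _ h
end
end

section
/- The characteristic polynomial of the matrix T equals λ^n + Σ_{i=1}^{⌊n/2⌋} σ_{2i} λ^{n−2i}, where σ_k denotes the k-th elementary symmetric polynomial in x_1,…,x_n. -/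
open MvPolynomial Matrix

noncomputable section

theorem Matrix.det_add_vecMulVec_add_det_sub_vecMulVec {m R : Type*} [Fintype m] [DecidableEq m]
    [CommRing R] [IsDomain R] {A : Matrix m m R} (hA : A.det ≠ 0) (u v : m → R) :
    (A + vecMulVec u v).det + (A - vecMulVec u v).det = 2 * A.det := by
  have field_case {K : Type _} [Field K] {B : Matrix m m K} (hB : B.det ≠ 0) (u v : m → K) :
      (B + vecMulVec u v).det + (B - vecMulVec u v).det = 2 * B.det := by
    have key (w : m → K) : (B + vecMulVec w v).det = B.det * (1 + v ⬝ᵥ (B⁻¹ *ᵥ w)) := by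
      rw [vecMulVec_eq Unit, det_add_replicateCol_mul_replicateRow hB.isUnit, Matrix.mul_assoc,
        ← replicateCol_mulVec, det_unique (n := Unit)]
      simp [Matrix.mul_apply, dotProduct]
    rw [sub_eq_add_neg, ← neg_vecMulVec, key, key, mulVec_neg, dotProduct_neg]
    ring
  let f := algebraMap R (FractionRing R)
  have hf : Function.Injective f := IsFractionRing.injective R (FractionRing R)
  have hB : (f.mapMatrix A).det ≠ 0 := by
    rw [← RingHom.map_det]
    exact (map_ne_zero_iff f hf).2 hA
  have hvec : f.mapMatrix (vecMulVec u v) = vecMulVec (f ∘ u) (f ∘ v) := by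
    ext i j
    simp [vecMulVec_apply]
  apply hf
  simp only [map_add, map_mul, map_ofNat, RingHom.map_det, map_sub, hvec]
  exact field_case hB _ _

theorem Finset.sum_range_add_neg_one_pow_mul {R : Type*} [CommRing R] (f : ℕ → R) (n : ℕ) :
    ∑ j ∈ Finset.range (n + 1), f j + ∑ j ∈ Finset.range (n + 1), (-1) ^ j * f j =
      2 * ∑ i ∈ Finset.range (n / 2 + 1), f (2 * i) := by
  induction n with
  | zero => simp [two_mul]
  | succ n ih =>
    rw [Finset.sum_range_succ, Finset.sum_range_succ (fun j => (-1) ^ j * f j),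
      add_add_add_comm, ih]
    obtain ⟨k, rfl | rfl⟩ := n.even_or_odd'
    · rw [show (2 * k + 1) / 2 = k by omega, show 2 * k / 2 = k by omega]
      simp [pow_succ]
    · rw [show (2 * k + 1 + 1) / 2 = k + 1 by omega, show (2 * k + 1) / 2 = k by omega,
        Finset.sum_range_succ _ (k + 1), show 2 * k + 1 + 1 = 2 * (k + 1) by ring, pow_mul]
      simp
      ring

theorem MvPolynomial.prod_X_sub_C_X_eq_sum_esymm (σ R : Type*) [Fintype σ] [CommRing R] :
    (∏ i : σ, (Polynomial.X - Polynomial.C (X i : MvPolynomial σ R))) =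
      ∑ j ∈ Finset.range (Fintype.card σ + 1), (-1) ^ j *
        (Polynomial.C (esymm σ R j) * Polynomial.X ^ (Fintype.card σ - j)) := by
  have h := Multiset.prod_X_sub_X_eq_sum_esymm
    (Finset.univ.val.map fun i : σ => (X i : MvPolynomial σ R))
  rw [Multiset.map_map, Multiset.card_map, Finset.card_val, Finset.card_univ] at h
  simp only [esymm_eq_multiset_esymm]
  exact h

theorem det_charmatrix_Tmat_add (n : ℕ) :
    ((Tmat n).charmatrix + vecMulVec 1 fun j => Polynomial.C (X j)).det =
      ∏ j, (Polynomial.X + Polynomial.C (X j)) := by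
  rw [det_of_isLowerTriangular]
  · simp [Tmat]
  · intro i j (hij : i < j)
    simp [Tmat, hij, hij.ne]

theorem det_charmatrix_Tmat_sub (n : ℕ) :
    ((Tmat n).charmatrix - vecMulVec 1 fun j => Polynomial.C (X j)).det =
      ∏ j, (Polynomial.X - Polynomial.C (X j)) := by
  rw [det_of_isUpperTriangular]
  · simp [Tmat]
  · intro i j (hij : j < i)
    simp [Tmat, hij, hij.ne', hij.not_gt]

theorem charpoly_Tmat (n : ℕ) (hn : 0 < n) :
    (Tmat n).charpoly =
      Polynomial.X ^ n +
        ∑ i ∈ Finset.Icc 1 (n / 2),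
          Polynomial.C (esymm (Fin n) ℂ (2 * i)) * Polynomial.X ^ (n - 2 * i) := by
  have hdet : (Tmat n).charmatrix.det ≠ 0 := (Tmat n).charpoly_monic.ne_zero
  have h := det_add_vecMulVec_add_det_sub_vecMulVec hdet 1 fun j => Polynomial.C (X j)
  rw [det_charmatrix_Tmat_add, det_charmatrix_Tmat_sub, prod_C_add_X_eq_sum_esymm,
    prod_X_sub_C_X_eq_sum_esymm, Finset.sum_range_add_neg_one_pow_mul, Fintype.card_fin] at h
  rw [charpoly, ← mul_left_cancel₀ two_ne_zero h, Finset.range_eq_Ico,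
    Finset.sum_eq_sum_Ico_succ_bot (Nat.succ_pos _)]
  simp [esymm_zero, Finset.Ico_add_one_right_eq_Icc]
end
end

section
/- In the formal power series ring R[[t]], the identity (Σ_{i≥0} σ_{2i} t^i) · (Σ_{k≥0} ζ_{2k} t^k) = Σ_{k≥0} σ_{2k+1} t^k holds, where σ_0 = 1 and σ_m = 0 for m > n. (This expresses that the central character generating function of the module V(s) is the rational function (Σ σ_{2i+1}(s) u^{−2i−1}) / (1 + Σ σ_{2i}(s) u^{−2i}).) -/
open MvPolynomial Matrix

noncomputable section

/-- The polynomial `ζ_m = vᵗ · C · T^m · v`, where `v` is the all-ones vector and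
`C = diag (x₁,…,xₙ)`. -/
def zeta (n m : ℕ) : MvPolynomial (Fin n) ℂ :=
  dotProduct (fun _ => 1)
    ((Matrix.diagonal fun i : Fin n => (X i : MvPolynomial (Fin n) ℂ)).mulVec
      ((Tmat n ^ m).mulVec (fun _ => 1)))

/-- Telescoping form of the Cayley-type recursion `y i * (1 + x i) = a - 2 * ∑ j < i, x j * y j`. -/
theorem sub_two_mul_sum_mul_prod_one_add {A : Type*} [CommRing A] (a : A) :
    ∀ (n : ℕ) (x y : Fin n → A),
      (∀ i, y i * (1 + x i) = a - 2 * ∑ j, if j < i then x j * y j else 0) →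
      (a - 2 * ∑ j, x j * y j) * ∏ j, (1 + x j) = a * ∏ j, (1 - x j)
  | 0, _, _, _ => by simp
  | n + 1, x, y, h => by
    have ih := sub_two_mul_sum_mul_prod_one_add a n (fun i => x i.castSucc)
      (fun i => y i.castSucc) fun i => by
        have hi := h i.castSucc
        rw [Fin.sum_univ_castSucc] at hi
        simpa [(Fin.castSucc_lt_last i).not_gt] using hi
    have hl := h (Fin.last n)
    rw [Fin.sum_univ_castSucc] at hl
    simp only [Fin.castSucc_lt_last, if_true, lt_irrefl, if_false, add_zero] at hl
    rw [Fin.sum_univ_castSucc, Fin.prod_univ_castSucc, Fin.prod_univ_castSucc]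
    linear_combination (1 - x (Fin.last n)) * ih -
      2 * x (Fin.last n) * (∏ j : Fin n, (1 + x j.castSucc)) * hl

theorem one_sub_sum_mul_prod_one_add {A : Type*} [CommRing A] {n : ℕ} (x y : Fin n → A)
    (h : ∀ i, y i = 1 + ∑ j, (if i < j then x j else if j < i then -x j else 0) * y j) :
    (1 - ∑ j, x j * y j) * ∏ j, (1 + x j) = (1 + ∑ j, x j * y j) * ∏ j, (1 - x j) := by
  rw [← sub_two_mul_sum_mul_prod_one_add (1 + ∑ j, x j * y j) n x y]
  · ring
  intro i
  have hi : y i * x i = ∑ j, if j = i then x j * y j else 0 := by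
    simp [mul_comm]
  rw [mul_add, mul_one, hi, h i, add_assoc, add_sub_assoc, Finset.mul_sum,
    ← Finset.sum_add_distrib, ← Finset.sum_sub_distrib]
  congr 1
  refine Finset.sum_congr rfl fun j _ => ?_
  rcases lt_trichotomy i j with hij | rfl | hij
  · simp [hij, hij.not_gt, hij.ne']
  · simp
  · simp only [hij, hij.not_gt, hij.ne, if_true, if_false]
    ring

theorem coeff_prod_one_add_X_mul_C (n m : ℕ) (c : MvPolynomial (Fin n) ℂ) :
    PowerSeries.coeff m (∏ i : Fin n, (1 + PowerSeries.X * PowerSeries.C (c * X i))) =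
      c ^ m * esymm (Fin n) ℂ m := by
  simp only [Finset.prod_one_add, map_sum, Finset.prod_mul_distrib, Finset.prod_const,
    ← map_prod, PowerSeries.coeff_mul_C, PowerSeries.coeff_X_pow]
  rw [esymm, Finset.mul_sum, ← Finset.sum_filter_add_sum_filter_not _ (fun t => t.card = m),
    add_eq_left.mpr (Finset.sum_eq_zero ?_)]
  · rw [← Finset.powersetCard_eq_filter]
    refine Finset.sum_congr rfl fun t ht => ?_
    simp [(Finset.mem_powersetCard.mp ht).2]
  · intro t ht
    simp [Ne.symm (Finset.mem_filter.mp ht).2]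

/-- The `i`-th entry of the resolvent vector `∑ m, u ^ m T ^ m v`. -/
def resolventEntry (n : ℕ) (i : Fin n) : PowerSeries (MvPolynomial (Fin n) ℂ) :=
  PowerSeries.mk fun m => ((Tmat n ^ m).mulVec fun _ => 1) i

theorem resolventEntry_eq (n : ℕ) (i : Fin n) :
    resolventEntry n i =
      1 + ∑ j, PowerSeries.X * (PowerSeries.C (Tmat n i j) * resolventEntry n j) := by
  rw [← Finset.mul_sum]
  ext1 m
  cases m with
  | zero => simp [resolventEntry]
  | succ m =>
    simp only [resolventEntry, pow_succ', ← Matrix.mulVec_mulVec, map_add, map_sum,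
      PowerSeries.coeff_succ_X_mul, PowerSeries.coeff_C_mul, PowerSeries.coeff_mk,
      PowerSeries.coeff_one, Nat.succ_ne_zero, if_false, zero_add]
    rfl

theorem sum_X_mul_resolventEntry (n : ℕ) :
    ∑ j : Fin n, PowerSeries.X * PowerSeries.C (X j) * resolventEntry n j =
      PowerSeries.X * PowerSeries.mk (zeta n) := by
  simp only [mul_assoc]
  rw [← Finset.mul_sum]
  congr 1
  ext1 m
  simp [resolventEntry, zeta, dotProduct, Matrix.mulVec_diagonal]

theorem one_sub_X_mul_zeta_mul_prod (n : ℕ) :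
    (1 - PowerSeries.X * PowerSeries.mk (zeta n)) *
        ∏ i : Fin n, (1 + PowerSeries.X * PowerSeries.C (X i : MvPolynomial (Fin n) ℂ)) =
      (1 + PowerSeries.X * PowerSeries.mk (zeta n)) *
        ∏ i : Fin n, (1 - PowerSeries.X * PowerSeries.C (X i : MvPolynomial (Fin n) ℂ)) := by
  have h := one_sub_sum_mul_prod_one_add (fun i => PowerSeries.X * PowerSeries.C (X i))
    (resolventEntry n) fun i => by
      refine (resolventEntry_eq n i).trans (congrArg (1 + ·) (Finset.sum_congr rfl fun j _ => ?_))
      rw [← mul_assoc, Tmat, Matrix.of_apply]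
      split_ifs <;> simp
  rwa [sum_X_mul_resolventEntry] at h

theorem X_mul_zeta_mul_prod_add_prod (n : ℕ) :
    PowerSeries.X * ((∏ i : Fin n, (1 + PowerSeries.X * PowerSeries.C (1 * X i)) +
        ∏ i : Fin n, (1 + PowerSeries.X * PowerSeries.C (-1 * X i))) *
          PowerSeries.mk (zeta n)) =
      ∏ i : Fin n, (1 + PowerSeries.X * PowerSeries.C (1 * X i)) -
        ∏ i : Fin n, (1 + PowerSeries.X * PowerSeries.C (-1 * X i)) := by
  have h := one_sub_X_mul_zeta_mul_prod n
  simp only [one_mul, neg_mul, map_neg, mul_neg, ← sub_eq_add_neg]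
  linear_combination -h

theorem generating_function_identity (n : ℕ) (hn : 0 < n) :
    (PowerSeries.mk fun i => esymm (Fin n) ℂ (2 * i)) *
        (PowerSeries.mk fun k => zeta n (2 * k)) =
      PowerSeries.mk fun k => esymm (Fin n) ℂ (2 * k + 1) := by
  ext1 k
  have h := congrArg (PowerSeries.coeff (2 * k + 1)) (X_mul_zeta_mul_prod_add_prod n)
  rw [PowerSeries.coeff_succ_X_mul, PowerSeries.coeff_mul] at h
  simp only [map_add, map_sub, coeff_prod_one_add_X_mul_C, PowerSeries.coeff_mk] at h
  have hsum : ∑ p ∈ Finset.HasAntidiagonal.antidiagonal k, 2 * (esymm (Fin n) ℂ (2 * p.1) * zeta n (2 * p.2)) =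
      ∑ p ∈ Finset.HasAntidiagonal.antidiagonal (2 * k), (1 ^ p.1 * esymm (Fin n) ℂ p.1 +
        (-1) ^ p.1 * esymm (Fin n) ℂ p.1) * zeta n p.2 := by
    refine Finset.sum_of_injOn (fun p => (2 * p.1, 2 * p.2)) ?_ ?_ ?_ ?_
    · rintro ⟨a, b⟩ _ ⟨c, d⟩ _ hp
      simp only [Prod.mk.injEq] at hp ⊢
      lia
    · rintro ⟨a, b⟩ hp
      simp only [Finset.mem_coe, Finset.HasAntidiagonal.mem_antidiagonal] at hp ⊢
      lia
    · rintro ⟨a, b⟩ hp hne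
      rw [Finset.HasAntidiagonal.mem_antidiagonal] at hp
      rcases Nat.even_or_odd a with ha | ha
      · obtain ⟨c, rfl⟩ := ha
        refine absurd ⟨(c, k - c), ?_, ?_⟩ hne
        · simp only [Finset.mem_coe, Finset.HasAntidiagonal.mem_antidiagonal]
          lia
        · simp only [Prod.mk.injEq]
          lia
      · simp [ha.neg_one_pow]
    · intro p _
      simp only [one_pow, even_two_mul, Even.neg_pow]
      ring
  rw [← hsum, ← Finset.mul_sum] at h
  simp only [PowerSeries.coeff_mul, PowerSeries.coeff_mk]
  refine mul_left_cancel₀ (two_ne_zero (α := MvPolynomial (Fin n) ℂ)) (h.trans ?_)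
  rw [(odd_two_mul_add_one k).neg_one_pow]
  ring
end
end

section
/- The n polynomials ζ_0, ζ_2, …, ζ_{2⌊(n−1)/2⌋} together with σ_2, σ_4, …, σ_{2⌊n/2⌋} are algebraically independent over ℂ, and the ℂ-subalgebra of R they generate is exactly the subalgebra of all symmetric polynomials in x_1,…,x_n. -/
open MvPolynomial Matrix

noncomputable section

/-- The family consisting of `ζ_0, ζ_2, …, ζ_{2⌊(n−1)/2⌋}` (indexed by `Fin ((n+1)/2)`, note
`⌊(n−1)/2⌋ + 1 = (n+1)/2` for `n ≥ 1`) together with `σ_2, σ_4, …, σ_{2⌊n/2⌋}` (indexed by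
`Fin (n/2)`). -/
def zetaEsymmFamily (n : ℕ) : (Fin ((n + 1) / 2) ⊕ Fin (n / 2)) → MvPolynomial (Fin n) ℂ :=
  Sum.elim (fun k => zeta n (2 * (k : ℕ))) (fun k => esymm (Fin n) ℂ (2 * ((k : ℕ) + 1)))

/-- A surjective endomorphism of a commutative Noetherian ring is injective. -/
theorem ringHom_injective_of_surjective {A : Type*} [CommRing A] [IsNoetherianRing A]
    (f : A →+* A) (hf : Function.Surjective f) : Function.Injective f := by
  have hmono : Monotone fun k : ℕ => RingHom.ker (f ^ k) := by
    refine monotone_nat_of_le_succ fun k a ha => ?_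
    rw [RingHom.mem_ker] at ha ⊢
    rw [pow_succ', RingHom.mul_def, RingHom.comp_apply, ha, map_zero]
  obtain ⟨k, hk⟩ := monotone_stabilizes_iff_noetherian.mpr
    (inferInstance : IsNoetherian A A) ⟨_, hmono⟩
  have hsurj : Function.Surjective (f ^ k : A →+* A) := by
    rw [RingHom.coe_pow]
    exact hf.iterate k
  rw [injective_iff_map_eq_zero]
  intro a ha
  obtain ⟨b, rfl⟩ := hsurj a
  have hb : b ∈ RingHom.ker (f ^ (k + 1)) := by
    rw [RingHom.mem_ker, pow_succ', RingHom.mul_def, RingHom.comp_apply, ha]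
  have hk' : RingHom.ker (f ^ k) = RingHom.ker (f ^ (k + 1)) := hk (k + 1) (Nat.le_succ k)
  rwa [← hk', RingHom.mem_ker] at hb

/-- If `w` solves the linear system `w i = 1 + ∑_{j > i} x j * w j - ∑_{j < i} x j * w j`, then
`∑ x j * w j` is the Cayley transform of `∏ (1 - x i) / ∏ (1 + x i)`. -/
theorem one_add_sum_mul_prod {A : Type*} [CommRing A] {n : ℕ} (x w : Fin n → A)
    (hw : ∀ i, w i = 1 + ∑ j, (if i < j then x j else if j < i then -x j else 0) * w j) :
    (1 + ∑ i, x i * w i) * ∏ i, (1 - x i) = (1 - ∑ i, x i * w i) * ∏ i, (1 + x i) := by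
  set P := ∑ i, x i * w i with hP
  have hw' (i : Fin n) :
      (1 + x i) * w i = 1 + P - 2 * ∑ j with j.val < i.val, x j * w j := by
    have h1 : ∑ j, (if i < j then x j else if j < i then -x j else 0) * w j
        = P - 2 * (∑ j with j.val < i.val, x j * w j) - x i * w i := by
      rw [hP, Finset.sum_filter, Finset.mul_sum, ← Finset.sum_sub_distrib, eq_sub_iff_add_eq]
      have h2 : x i * w i = ∑ j, if j = i then x j * w j else 0 := by simp
      rw [h2, ← Finset.sum_add_distrib]
      refine Finset.sum_congr rfl fun j _ => ?_
      rcases lt_trichotomy i j with h | h | h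
      · simp [h, h.ne', (Fin.lt_def.mp h).not_gt]
      · subst h
        simp
      · simp only [h, h.ne, h.not_gt, if_true, if_false, Fin.lt_def.mp h]
        ring
    linear_combination hw i + h1
  have key (k : ℕ) (hk : k ≤ n) :
      (1 + P) * ∏ i : Fin n with i.val < k, (1 - x i) =
        (1 + P - 2 * ∑ i : Fin n with i.val < k, x i * w i) *
          ∏ i : Fin n with i.val < k, (1 + x i) := by
    induction k with
    | zero => simp
    | succ k ih =>
      have hins : Finset.univ.filter (fun i : Fin n => i.val < k + 1) =
          insert ⟨k, hk⟩ (Finset.univ.filter fun i : Fin n => i.val < k) := by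
        ext i
        simp [Fin.ext_iff]
        omega
      have hnot : (⟨k, hk⟩ : Fin n) ∉ Finset.univ.filter fun i : Fin n => i.val < k := by simp
      have h := hw' ⟨k, hk⟩
      have ih := ih (by omega)
      rw [hins, Finset.prod_insert hnot, Finset.prod_insert hnot, Finset.sum_insert hnot]
      linear_combination (1 - x ⟨k, hk⟩) * ih +
        2 * x ⟨k, hk⟩ * (∏ i : Fin n with i.val < k, (1 + x i)) * h
  have h := key n le_rfl
  simp only [Fin.is_lt, Finset.filter_true] at h
  rw [h, ← hP]
  ring

theorem coeff_prod_one_add_C_mul_X (n : ℕ) (c : MvPolynomial (Fin n) ℂ) (k : ℕ) :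
    PowerSeries.coeff k (∏ i : Fin n, (1 + PowerSeries.C (c * X i) * PowerSeries.X)) =
      c ^ k * esymm (Fin n) ℂ k := by
  rw [Finset.prod_one_add, map_sum, esymm, Finset.mul_sum, Finset.powersetCard_eq_filter,
    Finset.sum_filter]
  refine Finset.sum_congr rfl fun t _ => ?_
  rw [Finset.prod_mul_distrib, ← map_prod, Finset.prod_const, PowerSeries.coeff_C_mul,
    PowerSeries.coeff_X_pow, Finset.prod_mul_distrib, Finset.prod_const]
  rcases eq_or_ne t.card k with h | h
  · simp [h]
  · simp [h, h.symm]

theorem esymm_mem_symmetricSubalgebra (n k : ℕ) :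
    esymm (Fin n) ℂ k ∈ symmetricSubalgebra (Fin n) ℂ :=
  esymm_isSymmetric _ _ _

theorem zeta_eq_sum (n m : ℕ) :
    zeta n m = ∑ i, X i * ((Tmat n ^ m).mulVec (fun _ => 1)) i := by
  simp [zeta, dotProduct, Matrix.mulVec_diagonal]

/-- The even-indexed `ζ` and the even-indexed `σ` convolve to the odd-indexed `σ`. -/
theorem sum_zeta_mul_esymm (n k : ℕ) :
    ∑ p ∈ Finset.HasAntidiagonal.antidiagonal (2 * k),
      zeta n p.1 * ((1 + (-1) ^ p.2) * esymm (Fin n) ℂ p.2) = 2 * esymm (Fin n) ℂ (2 * k + 1) := by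
  let u : ℕ → Fin n → MvPolynomial (Fin n) ℂ := fun m => (Tmat n ^ m).mulVec fun _ => 1
  let w : Fin n → PowerSeries (MvPolynomial (Fin n) ℂ) := fun i => PowerSeries.mk fun m => u m i
  let x : Fin n → PowerSeries (MvPolynomial (Fin n) ℂ) :=
    fun i => PowerSeries.C (X i) * PowerSeries.X
  have hu (m : ℕ) (i : Fin n) : u (m + 1) i = ∑ j, Tmat n i j * u m j := by
    simp only [u, pow_succ', ← Matrix.mulVec_mulVec]
    rfl
  have hw (i : Fin n) :
      w i = 1 + ∑ j, (if i < j then x j else if j < i then -x j else 0) * w j := by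
    have hT (j : Fin n) : (if i < j then x j else if j < i then -x j else 0) * w j =
        PowerSeries.C (Tmat n i j) * w j * PowerSeries.X := by
      simp only [Tmat, Matrix.of_apply, x]
      split_ifs <;> try simp only [map_neg, map_zero]
      all_goals ring
    simp only [hT]
    ext1 m
    cases m with
    | zero => simp [w, u]
    | succ m =>
      simp [PowerSeries.coeff_one, map_sum, w, hu]
  have hZ : ∑ i, x i * w i = PowerSeries.mk (zeta n) * PowerSeries.X := by
    ext1 m
    cases m with
    | zero => simp [x]
    | succ m =>
      have (i : Fin n) : x i * w i = PowerSeries.C (X i) * w i * PowerSeries.X := by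
        simp only [x]; ring
      simp only [this, map_sum, PowerSeries.coeff_succ_mul_X, PowerSeries.coeff_C_mul,
        PowerSeries.coeff_mk, w, zeta_eq_sum, u]
  have h := one_add_sum_mul_prod x w hw
  have hneg : ∏ i, (1 - x i) = ∏ i : Fin n, (1 + PowerSeries.C (-1 * X i) * PowerSeries.X) :=
    Finset.prod_congr rfl fun i _ => by simp [x, sub_eq_add_neg]
  have hpos : ∏ i, (1 + x i) = ∏ i : Fin n, (1 + PowerSeries.C (1 * X i) * PowerSeries.X) :=
    Finset.prod_congr rfl fun i _ => by simp [x]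
  rw [hZ] at h
  have h' : PowerSeries.mk (zeta n) * (∏ i, (1 + x i) + ∏ i, (1 - x i)) * PowerSeries.X =
      ∏ i, (1 + x i) - ∏ i, (1 - x i) := by
    linear_combination h
  have h'' := congrArg (PowerSeries.coeff (2 * k + 1)) h'
  rw [hneg, hpos, PowerSeries.coeff_succ_mul_X, PowerSeries.coeff_mul, map_sub,
    coeff_prod_one_add_C_mul_X, coeff_prod_one_add_C_mul_X] at h''
  simp only [map_add, coeff_prod_one_add_C_mul_X, PowerSeries.coeff_mk, one_pow, ← add_mul] at h''
  rw [h'', Odd.neg_one_pow (by simp)]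
  ring

theorem mem_of_two_mul_mem {n : ℕ} (S : Subalgebra ℂ (MvPolynomial (Fin n) ℂ))
    {p : MvPolynomial (Fin n) ℂ} (h : 2 * p ∈ S) : p ∈ S := by
  have h2 : p = (2⁻¹ : ℂ) • (2 * p) := by
    rw [two_mul, ← two_smul ℂ p, smul_smul, inv_mul_cancel₀ two_ne_zero, one_smul]
  rw [h2]
  exact S.smul_mem h _

theorem zeta_two_mul_mem_symmetricSubalgebra (n k : ℕ) :
    zeta n (2 * k) ∈ symmetricSubalgebra (Fin n) ℂ := by
  induction k using Nat.strong_induction_on with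
  | _ k ih =>
    have h := sum_zeta_mul_esymm n k
    have hmem : (2 * k, 0) ∈ Finset.HasAntidiagonal.antidiagonal (2 * k) := by simp
    rw [← Finset.add_sum_erase _ _ hmem] at h
    apply mem_of_two_mul_mem
    have h' := eq_sub_of_add_eq h
    simp only [pow_zero, esymm_zero] at h'
    rw [show 2 * zeta n (2 * k) = zeta n (2 * k) * ((1 + 1) * 1) by ring, h']
    refine Subalgebra.sub_mem _ ?_ (Subalgebra.sum_mem _ ?_)
    · exact Subalgebra.mul_mem _ (ofNat_mem _ 2) (esymm_mem_symmetricSubalgebra n _)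
    · rintro ⟨a, b⟩ hp
      simp only [Finset.mem_erase, Finset.HasAntidiagonal.mem_antidiagonal, ne_eq,
        Prod.mk.injEq] at hp
      rcases Nat.even_or_odd' b with ⟨c, rfl | rfl⟩
      · obtain rfl : a = 2 * (k - c) := by omega
        refine Subalgebra.mul_mem _ (ih _ (by omega)) (Subalgebra.mul_mem _ ?_
          (esymm_mem_symmetricSubalgebra n _))
        rw [Even.neg_one_pow (even_two_mul c)]
        exact add_mem (one_mem _) (one_mem _)
      · simp [pow_succ, pow_mul]

theorem esymm_mem_adjoin_zetaEsymmFamily (n m : ℕ) (hm : m ≤ n) :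
    esymm (Fin n) ℂ m ∈ Algebra.adjoin ℂ (Set.range (zetaEsymmFamily n)) := by
  have heven (c : ℕ) (hc : 2 * c ≤ n) :
      esymm (Fin n) ℂ (2 * c) ∈ Algebra.adjoin ℂ (Set.range (zetaEsymmFamily n)) := by
    cases c with
    | zero => simp
    | succ c => exact Algebra.subset_adjoin ⟨Sum.inr ⟨c, by omega⟩, rfl⟩
  rcases Nat.even_or_odd' m with ⟨k, rfl | rfl⟩
  · exact heven k hm
  · apply mem_of_two_mul_mem
    rw [← sum_zeta_mul_esymm n k]
    refine Subalgebra.sum_mem _ ?_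
    rintro ⟨a, b⟩ hp
    rw [Finset.HasAntidiagonal.mem_antidiagonal] at hp
    simp only at hp
    rcases Nat.even_or_odd' b with ⟨c, rfl | rfl⟩
    · obtain rfl : a = 2 * (k - c) := by omega
      refine Subalgebra.mul_mem _
        (Algebra.subset_adjoin ⟨Sum.inl ⟨k - c, by omega⟩, rfl⟩)
        (Subalgebra.mul_mem _ ?_ (heven c (by omega)))
      rw [Even.neg_one_pow (even_two_mul c)]
      exact add_mem (one_mem _) (one_mem _)
    · simp [pow_succ, pow_mul]

theorem adjoin_range_zetaEsymmFamily (n : ℕ) :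
    Algebra.adjoin ℂ (Set.range (zetaEsymmFamily n)) = symmetricSubalgebra (Fin n) ℂ := by
  apply le_antisymm
  · rw [Algebra.adjoin_le_iff]
    rintro _ ⟨k | k, rfl⟩
    · exact zeta_two_mul_mem_symmetricSubalgebra n k
    · exact esymm_mem_symmetricSubalgebra n (2 * (k + 1))
  · intro p hp
    obtain ⟨q, hq⟩ := (esymmAlgHom_fin_bijective ℂ n).2 ⟨p, hp⟩
    have hpq : p = aeval (fun i : Fin n => esymm (Fin n) ℂ (i + 1)) q := by
      rw [← esymmAlgHom_apply, hq]
    rw [hpq]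
    have hsub : Algebra.adjoin ℂ (Set.range fun i : Fin n => esymm (Fin n) ℂ (i + 1)) ≤
        Algebra.adjoin ℂ (Set.range (zetaEsymmFamily n)) := by
      rw [Algebra.adjoin_le_iff]
      rintro _ ⟨i, rfl⟩
      exact esymm_mem_adjoin_zetaEsymmFamily n _ i.isLt
    apply hsub
    rw [Algebra.adjoin_range_eq_range_aeval]
    exact ⟨q, rfl⟩

/-- As many elements as variables that generate the algebra of symmetric polynomials are
algebraically independent. -/
theorem algebraicIndependent_of_adjoin_eq_symmetricSubalgebra {n : ℕ} {ι : Type*} (e : ι ≃ Fin n)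
    (f : ι → MvPolynomial (Fin n) ℂ)
    (hf : Algebra.adjoin ℂ (Set.range f) = symmetricSubalgebra (Fin n) ℂ) :
    AlgebraicIndependent ℂ f := by
  let E := esymmAlgEquiv (Fin n) ℂ (Fintype.card_fin n)
  have hrange : (aeval f : MvPolynomial ι ℂ →ₐ[ℂ] _).range = symmetricSubalgebra (Fin n) ℂ := by
    rw [← hf, Algebra.adjoin_range_eq_range_aeval]
  have hmem (p : MvPolynomial ι ℂ) : aeval f p ∈ symmetricSubalgebra (Fin n) ℂ := by
    rw [← hrange]
    exact ⟨p, rfl⟩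
  let g : MvPolynomial ι ℂ →ₐ[ℂ] symmetricSubalgebra (Fin n) ℂ := (aeval f).codRestrict _ hmem
  have hg : Function.Surjective g := by
    rintro ⟨p, hp⟩
    rw [← hrange] at hp
    obtain ⟨q, hq⟩ := hp
    exact ⟨q, Subtype.ext hq⟩
  let φ : MvPolynomial (Fin n) ℂ →ₐ[ℂ] MvPolynomial (Fin n) ℂ :=
    (E.symm.toAlgHom.comp g).comp (renameEquiv ℂ e.symm).toAlgHom
  have hφ : Function.Surjective φ :=
    (E.symm.surjective.comp hg).comp (renameEquiv ℂ e.symm).surjective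
  have hinj : Function.Injective φ := ringHom_injective_of_surjective φ.toRingHom hφ
  intro p q hpq
  have hgpq : g p = g q := Subtype.ext hpq
  have h : φ (renameEquiv ℂ e p) = φ (renameEquiv ℂ e q) := by
    simp [φ, hgpq]
  exact (renameEquiv ℂ e).injective (hinj h)

theorem zeta_esymm_generators (n : ℕ) (hn : 0 < n) :
    AlgebraicIndependent ℂ (zetaEsymmFamily n) ∧
      Algebra.adjoin ℂ (Set.range (zetaEsymmFamily n)) = symmetricSubalgebra (Fin n) ℂ := by
  have e : (Fin ((n + 1) / 2) ⊕ Fin (n / 2)) ≃ Fin n :=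
    finSumFinEquiv.trans (finCongr (by omega))
  exact ⟨algebraicIndependent_of_adjoin_eq_symmetricSubalgebra e _
    (adjoin_range_zetaEsymmFamily n), adjoin_range_zetaEsymmFamily n⟩
end
end

section
/- Let m be a finite multiset of complex numbers. Then the odd power sums of m all vanish, i.e. Σ_{a ∈ m} a^{2k+1} = 0 for every k ≥ 0, if and only if m is invariant under negation as a multiset (equivalently, m consists of zeros together with pairs {a, −a}). -/
/-- Multisets with the same power sums integrate polynomials in the same way. -/
theorem Multiset.sum_map_eval_eq_of_sum_map_pow_eq {R : Type*} [CommSemiring R]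
    {s t : Multiset R} (h : ∀ n : ℕ, (s.map (· ^ n)).sum = (t.map (· ^ n)).sum)
    (p : Polynomial R) : (s.map p.eval).sum = (t.map p.eval).sum := by
  induction p using Polynomial.induction_on' with
  | add p q hp hq =>
    simpa only [Polynomial.eval_add, Multiset.sum_map_add] using congrArg₂ (· + ·) hp hq
  | monomial n c =>
    simpa only [Polynomial.eval_monomial, Multiset.sum_map_mul_left] using congrArg (c * ·) (h n)

/-- Over a field of characteristic zero, a multiset is determined by its power sums. -/
theorem Multiset.eq_of_sum_map_pow_eq {K : Type*} [Field K] [CharZero K] {s t : Multiset K}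
    (h : ∀ n : ℕ, (s.map (· ^ n)).sum = (t.map (· ^ n)).sum) : s = t := by
  classical
  ext a
  let p := Lagrange.interpolate (s + t).toFinset id fun x => if x = a then (1 : K) else 0
  have hp : ∀ x ∈ s + t, p.eval x = if x = a then 1 else 0 := fun x hx =>
    Lagrange.eval_interpolate_at_node (v := id) _ (Function.injective_id.injOn)
      (Multiset.mem_toFinset.2 hx)
  have hcount : ∀ u ≤ s + t, (u.map p.eval).sum = (u.count a : K) := fun u hu => by
    rw [Multiset.map_congr rfl fun x hx => hp x (Multiset.mem_of_le hu hx),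
      Multiset.sum_map_eq_nsmul_single a fun x hx _ => if_neg hx, if_pos rfl, nsmul_one]
  have := Multiset.sum_map_eval_eq_of_sum_map_pow_eq h p
  rw [hcount s (Multiset.le_add_right s t), hcount t (Multiset.le_add_left t s)] at this
  exact_mod_cast this

theorem odd_power_sums_vanish_iff (m : Multiset ℂ) :
    (∀ k : ℕ, (m.map fun a => a ^ (2 * k + 1)).sum = 0) ↔ m.map (fun a => -a) = m := by
  constructor
  · intro h
    refine Multiset.eq_of_sum_map_pow_eq fun n => ?_
    rw [Multiset.map_map]
    rcases n.even_or_odd with hn | hn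
    · simp only [Function.comp_def, hn.neg_pow]
    · simp only [Function.comp_def, hn.neg_pow, Multiset.sum_map_neg]
      obtain ⟨k, rfl⟩ := hn
      rw [h k, neg_zero]
  · intro h k
    have := congrArg (fun s => (Multiset.map (fun a => a ^ (2 * k + 1)) s).sum) h
    simp only [Multiset.map_map, Function.comp_def, (odd_two_mul_add_one k).neg_pow,
      Multiset.sum_map_neg] at this
    exact neg_eq_self.1 this
end

section
/- Let s and s' be finite multisets of complex numbers. Then Σ_{a ∈ s} a^{2k+1} = Σ_{a ∈ s'} a^{2k+1} for every k ≥ 0 if and only if there exist multisets c, r, r' of complex numbers with r and r' each invariant under negation, s = c + r and s' = c + r' (i.e., s and s' have the same core, the core being obtained by removing all zeros and all pairs of elements summing to zero). -/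
open Polynomial in
theorem Multiset.eq_of_forall_sum_map_pow_eq {R : Type*} [CommRing R] [IsDomain R] [CharZero R]
    {s t : Multiset R} (h : ∀ k : ℕ, (s.map (· ^ k)).sum = (t.map (· ^ k)).sum) : s = t := by
  classical
  have eval_sum_eq (p : R[X]) : (s.map fun x => p.eval x).sum = (t.map fun x => p.eval x).sum := by
    induction p using Polynomial.induction_on' with
    | add p q hp hq => simp only [eval_add, Multiset.sum_map_add, hp, hq]
    | monomial n a => simp only [eval_monomial, Multiset.sum_map_mul_left, h]
  ext a
  let p : R[X] := ∏ b ∈ (s + t).toFinset.erase a, (X - C b)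
  have eval_ne_zero : p.eval a ≠ 0 := by
    simp only [p, eval_prod, eval_sub, eval_X, eval_C]
    exact Finset.prod_ne_zero_iff.2 fun b hb => sub_ne_zero.2 (Finset.ne_of_mem_erase hb).symm
  have eval_sum (u : Multiset R) (hu : u ≤ s + t) :
      (u.map fun x => p.eval x).sum = u.count a * p.eval a := by
    rw [Finset.sum_multiset_map_count, Finset.sum_eq_single a, nsmul_eq_mul]
    · intro b hb hba
      have hmem : b ∈ (s + t).toFinset.erase a :=
        Finset.mem_erase.2 ⟨hba, Multiset.mem_toFinset.2
          (Multiset.mem_of_le hu (Multiset.mem_toFinset.1 hb))⟩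
      have : p.eval b = 0 := by
        simp only [p, eval_prod, eval_sub, eval_X, eval_C]
        exact Finset.prod_eq_zero hmem (sub_self b)
      rw [this, smul_zero]
    · intro ha
      rw [Multiset.count_eq_zero.2 (mt Multiset.mem_toFinset.2 ha), zero_smul]
  have key := eval_sum_eq p
  rw [eval_sum s (Multiset.le_add_right s t), eval_sum t (Multiset.le_add_left t s)] at key
  exact_mod_cast mul_right_cancel₀ eval_ne_zero key

theorem Multiset.sum_map_odd_pow_eq_zero {R : Type*} [CommRing R] [IsDomain R] [CharZero R]
    {r : Multiset R} (hr : r.map (fun a => -a) = r) {n : ℕ} (hn : Odd n) :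
    (r.map (· ^ n)).sum = 0 := by
  have h : (r.map (· ^ n)).sum = -(r.map (· ^ n)).sum := by
    conv_lhs => rw [← hr]
    simp [Multiset.map_map, hn.neg_pow]
  exact self_eq_neg.1 h

theorem Multiset.count_map_neg {G : Type*} [InvolutiveNeg G] [DecidableEq G]
    (s : Multiset G) (a : G) : (s.map fun x => -x).count a = s.count (-a) := by
  simpa using Multiset.count_map_eq_count' (fun x : G => -x) s neg_injective (-a)

theorem odd_power_sums_eq_iff_same_core (s s' : Multiset ℂ) :
    (∀ k : ℕ, (s.map fun a => a ^ (2 * k + 1)).sum = (s'.map fun a => a ^ (2 * k + 1)).sum) ↔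
      ∃ c r r' : Multiset ℂ,
        r.map (fun a => -a) = r ∧ r'.map (fun a => -a) = r' ∧ s = c + r ∧ s' = c + r' := by
  classical
  constructor
  · intro h
    have heq : s + s'.map (fun a => -a) = s' + s.map (fun a => -a) := by
      refine Multiset.eq_of_forall_sum_map_pow_eq fun n => ?_
      rcases Nat.even_or_odd n with hn | hn
      · simp [Multiset.map_map, hn.neg_pow, add_comm]
      · obtain ⟨k, rfl⟩ := id hn
        simp [Multiset.map_map, hn.neg_pow, h k]
    have hcount (a : ℂ) : s.count a + s'.count (-a) = s'.count a + s.count (-a) := by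
      simpa only [Multiset.count_add, Multiset.count_map_neg] using congrArg (Multiset.count a) heq
    refine ⟨s ∩ s', s - s', s' - s, ?_, ?_, ?_, ?_⟩ <;> ext a <;>
      simp only [Multiset.count_map_neg, Multiset.count_add, Multiset.count_sub,
        Multiset.count_inter] <;>
      have := hcount a <;> omega
  · rintro ⟨c, r, r', hr, hr', rfl, rfl⟩ k
    have hk : Odd (2 * k + 1) := odd_two_mul_add_one k
    simp [Multiset.sum_map_odd_pow_eq_zero hr hk, Multiset.sum_map_odd_pow_eq_zero hr' hk]
end

section
/- If s ∈ ℂ^n is typical, i.e. s_i + s_j ≠ 0 for all i ≠ j, then the n vectors v, T(s)v, T(s)^2 v, …, T(s)^{n−1} v form a basis of ℂ^n (equivalently, the matrix whose rows are these vectors is invertible). -/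
open Matrix

noncomputable section

/-- For `s ∈ ℂⁿ`, the matrix `T(s)` with `T(s) i j = s j` for `i < j`, `-s j` for `i > j`,
and `0` on the diagonal. -/
def Ts {n : ℕ} (s : Fin n → ℂ) : Matrix (Fin n) (Fin n) ℂ :=
  Matrix.of fun i j => if i < j then s j else if j < i then -s j else 0

/-- A sequence that vanishes at `0` and `n` and satisfies
`(μ - s j) P (j + 1) = (μ + s j) P j` vanishes in between when `s i + s j ≠ 0` for `i ≠ j`. -/
lemma eq_zero_of_recurrence {K : Type*} [Field K] {n : ℕ} {s : Fin n → K}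
    (htyp : ∀ i j : Fin n, i ≠ j → s i + s j ≠ 0) {μ : K} {P : ℕ → K}
    (h0 : P 0 = 0) (hn : P n = 0)
    (hrec : ∀ j : Fin n, (μ - s j) * P (j + 1) = (μ + s j) * P j) :
    ∀ m ≤ n, P m = 0 := by
  intro m
  induction m with
  | zero => exact fun _ => h0
  | succ j ih =>
    intro hj
    by_contra hP
    have hjn : j < n := hj
    have h1 := hrec ⟨j, hjn⟩
    simp only [ih (by omega), mul_zero, mul_eq_zero, hP, or_false] at h1
    have key : ∀ q, j + 1 ≤ q → q ≤ n → P q ≠ 0 := by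
      intro q hq
      induction q, hq using Nat.le_induction with
      | base => exact fun _ => hP
      | succ q hq ihq =>
        intro hqn hPq
        have h2 := hrec ⟨q, hqn⟩
        simp only [hPq, mul_zero, zero_eq_mul, ihq (by omega), or_false] at h2
        refine htyp ⟨j, hjn⟩ ⟨q, hqn⟩ (by simp only [ne_eq, Fin.mk.injEq]; omega) ?_
        linear_combination h2 - h1
    exact key n hj le_rfl hn

/-- For typical `s`, a left eigenvector of `T(s)` whose entries sum to zero is zero. -/
lemma eq_zero_of_transpose_Ts_mulVec {n : ℕ} {s : Fin n → ℂ}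
    (htyp : ∀ i j : Fin n, i ≠ j → s i + s j ≠ 0) {μ : ℂ} {w : Fin n → ℂ}
    (hsum : ∑ i, w i = 0) (hw : (Ts s)ᵀ *ᵥ w = μ • w) : w = 0 := by
  let P : ℕ → ℂ := fun m => ∑ i : Fin n, if (i : ℕ) < m then w i else 0
  have hsucc (j : Fin n) : P (j + 1) = P j + w j := by
    have : w j = ∑ i : Fin n, if i = j then w i else 0 := by simp
    rw [this, ← Finset.sum_add_distrib]
    refine Finset.sum_congr rfl fun i _ => ?_
    rcases lt_trichotomy i j with h | rfl | h
    · simp [h, h.ne, Nat.lt_succ_of_lt (Fin.lt_def.mp h)]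
    · simp
    · have h' := Fin.lt_def.mp h
      simp [h.ne', h.not_gt, not_lt.mpr (Nat.succ_le_of_lt h')]
  have hentry (j : Fin n) : ((Ts s)ᵀ *ᵥ w) j = s j * (P j + P (j + 1)) := by
    have : P j + P (j + 1) = P j + P (j + 1) - ∑ i, w i := by rw [hsum, sub_zero]
    rw [this, ← Finset.sum_add_distrib, ← Finset.sum_sub_distrib, Finset.mul_sum,
      Matrix.mulVec, dotProduct]
    refine Finset.sum_congr rfl fun i _ => ?_
    rcases lt_trichotomy i j with h | rfl | h
    · simp [Ts, h, Nat.lt_succ_of_lt (Fin.lt_def.mp h)]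
    · simp [Ts]
    · have h' := Fin.lt_def.mp h
      simp [Ts, h, h.not_gt, not_lt.mpr (Nat.succ_le_of_lt h')]
  have hP : ∀ m ≤ n, P m = 0 := by
    refine eq_zero_of_recurrence htyp (μ := μ) (by simp [P]) (by simpa [P] using hsum) fun j => ?_
    have h := congrFun hw j
    rw [hentry, Pi.smul_apply, smul_eq_mul] at h
    linear_combination -h + μ * hsucc j
  funext j
  have h := hsucc j
  rw [hP _ j.isLt, hP _ j.isLt.le, zero_add] at h
  exact h.symm

/-- If `w` is orthogonal to the first `n` Krylov vectors of `A`, it is orthogonal to all of them. -/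
lemma pow_mulVec_dotProduct_eq_zero {K : Type*} [Field K] {n : ℕ}
    {A : Matrix (Fin n) (Fin n) K} {v w : Fin n → K}
    (h : ∀ k < n, (A ^ k *ᵥ v) ⬝ᵥ w = 0) (k : ℕ) : (A ^ k *ᵥ v) ⬝ᵥ w = 0 := by
  rcases Nat.eq_zero_or_pos n with rfl | hn
  · simp
  have : Nonempty (Fin n) := ⟨⟨0, hn⟩⟩
  have hdeg : (Polynomial.X ^ k %ₘ A.charpoly).natDegree < n := by
    have := Polynomial.natDegree_modByMonic_lt (Polynomial.X ^ k) A.charpoly_monic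
      (fun h1 => by
        have := A.charpoly_natDegree_eq_dim
        simp [h1] at this
        omega)
    simpa using this
  rw [Matrix.pow_eq_aeval_mod_charpoly, Polynomial.aeval_eq_sum_range' hdeg, Matrix.sum_mulVec,
    sum_dotProduct]
  refine Finset.sum_eq_zero fun i hi => ?_
  rw [Matrix.smul_mulVec, smul_dotProduct, h i (Finset.mem_range.mp hi), smul_zero]

/-- Over an algebraically closed field, if no left eigenvector of `A` is orthogonal to `v`, then
the Krylov matrix of `A` and `v` is invertible. -/
lemma isUnit_krylov {K : Type*} [Field K] [IsAlgClosed K] {n : ℕ}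
    {A : Matrix (Fin n) (Fin n) K} {v : Fin n → K}
    (h : ∀ (μ : K) (w : Fin n → K), v ⬝ᵥ w = 0 → Aᵀ *ᵥ w = μ • w → w = 0) :
    IsUnit (Matrix.of fun k i : Fin n => (A ^ (k : ℕ) *ᵥ v) i) := by
  let W : Submodule K (Fin n → K) :=
    { carrier := {w | ∀ k : ℕ, (A ^ k *ᵥ v) ⬝ᵥ w = 0}
      add_mem' := fun ha hb k => by rw [dotProduct_add, ha k, hb k, add_zero]
      zero_mem' := fun k => dotProduct_zero _
      smul_mem' := fun c x hx k => by rw [dotProduct_smul, hx k, smul_zero] }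
  have hinv : ∀ w ∈ W, Matrix.toLin' Aᵀ w ∈ W := by
    intro w hw k
    rw [Matrix.toLin'_apply, Matrix.dotProduct_mulVec, Matrix.vecMul_transpose,
      Matrix.mulVec_mulVec, ← pow_succ']
    exact hw (k + 1)
  have hW : W = ⊥ := by
    by_contra hne
    have : Nontrivial W := Submodule.nontrivial_iff_ne_bot.mpr hne
    obtain ⟨μ, hμ⟩ := Module.End.exists_eigenvalue ((Matrix.toLin' Aᵀ).restrict hinv)
    obtain ⟨w, hw⟩ := hμ.exists_hasEigenvector
    refine hw.2 (Subtype.ext (h μ w ?_ ?_))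
    · simpa using w.2 0
    · simpa using congrArg Subtype.val hw.apply_eq_smul
  rw [← Matrix.mulVec_injective_iff_isUnit]
  refine (injective_iff_map_eq_zero (Matrix.mulVecLin _)).mpr fun w hw => ?_
  have hmem : w ∈ W := pow_mulVec_dotProduct_eq_zero fun k hk => congrFun hw ⟨k, hk⟩
  rwa [hW, Submodule.mem_bot] at hmem

theorem typical_implies_invertible {n : ℕ} (hn : 0 < n) (s : Fin n → ℂ)
    (htyp : ∀ i j : Fin n, i ≠ j → s i + s j ≠ 0) :
    IsUnit (Matrix.of fun k i : Fin n => ((Ts s ^ (k : ℕ)).mulVec (fun _ => 1)) i) :=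
  isUnit_krylov fun _ _ hv hw =>
    eq_zero_of_transpose_Ts_mulVec htyp (by simpa [dotProduct] using hv) hw
end
end

section
/- Let A be a commutative ring and a = (a_1,…,a_n) ∈ A^n with a_1 + a_2 = 0. Then for every k ≥ 0, the first and the second coordinates of the vector T(a)^k v coincide. Consequently, if s ∈ ℂ^n satisfies s_1 = −s_2, the n vectors v, T(s)v, …, T(s)^{n−1} v are linearly dependent over ℂ. -/
open Matrix

noncomputable section

/-- For a tuple `a` of elements of a commutative ring `A`, the matrix `T(a)` with
`T(a) i j = a j` for `i < j`, `-a j` for `i > j`, and `0` on the diagonal. -/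
def Tgen {A : Type*} [CommRing A] {n : ℕ} (a : Fin n → A) : Matrix (Fin n) (Fin n) A :=
  Matrix.of fun i j => if i < j then a j else if j < i then -a j else 0

theorem Tgen_mulVec_zero_sub_one {A : Type*} [CommRing A] {n : ℕ} (a w : Fin (n + 2) → A) :
    (Tgen a *ᵥ w) 0 - (Tgen a *ᵥ w) 1 = a 0 * w 0 + a 1 * w 1 := by
  simp only [mulVec, dotProduct, Tgen, of_apply, Fin.sum_univ_succ, Fin.lt_def, Fin.val_succ,
    Fin.val_zero]
  simp [add_comm]

theorem Tgen_pow_mulVec_one_zero_eq_one {A : Type*} [CommRing A] {n : ℕ} (a : Fin (n + 2) → A)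
    (ha : a 0 + a 1 = 0) (k : ℕ) :
    ((Tgen a ^ k) *ᵥ (fun _ => 1)) 0 = ((Tgen a ^ k) *ᵥ (fun _ => 1)) 1 := by
  induction k with
  | zero => simp
  | succ k ih =>
    rw [pow_succ', ← mulVec_mulVec, ← sub_eq_zero, Tgen_mulVec_zero_sub_one, ih, ← add_mul, ha,
      zero_mul]

theorem first_two_coords_coincide {n : ℕ} (hn : 1 < n) (A : Type*) [CommRing A]
    (a : Fin n → A) (ha : a ⟨0, by omega⟩ + a ⟨1, hn⟩ = 0) :
    (∀ k : ℕ, ((Tgen a ^ k).mulVec (fun _ => 1)) ⟨0, by omega⟩ =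
        ((Tgen a ^ k).mulVec (fun _ => 1)) ⟨1, hn⟩) ∧
      (∀ s : Fin n → ℂ, s ⟨0, by omega⟩ = -s ⟨1, hn⟩ →
        ¬ LinearIndependent ℂ (fun k : Fin n => (Tgen s ^ (k : ℕ)).mulVec (fun _ => (1 : ℂ)))) := by
  obtain ⟨m, rfl⟩ : ∃ m, n = m + 2 := ⟨n - 2, by omega⟩
  refine ⟨Tgen_pow_mulVec_one_zero_eq_one a ha, fun s hs hli => ?_⟩
  have hspan := hli.span_eq_top_of_card_eq_finrank' (by simp)
  have hle : Submodule.span ℂ (Set.range fun k : Fin (m + 2) =>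
      (Tgen s ^ (k : ℕ)).mulVec (fun _ => (1 : ℂ))) ≤
      LinearMap.eqLocus (LinearMap.proj 0 : (Fin (m + 2) → ℂ) →ₗ[ℂ] ℂ) (LinearMap.proj 1) := by
    rw [Submodule.span_le]
    rintro _ ⟨k, rfl⟩
    exact Tgen_pow_mulVec_one_zero_eq_one s (eq_neg_iff_add_eq_zero.mp hs) k
  have hsingle : (Pi.single 0 1 : Fin (m + 2) → ℂ) 0 = (Pi.single 0 1 : Fin (m + 2) → ℂ) 1 :=
    hspan.ge.trans hle (Submodule.mem_top (x := Pi.single 0 1))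
  simp at hsingle
end
end

section
/- Let V be a ℂ-vector space, Q a quadratic form on V, and suppose the Clifford algebra Cl(Q) admits a nonzero finite-dimensional module M. Then the polar bilinear form B of Q (B(x,y) = Q(x+y) − Q(x) − Q(y)) has finite rank, i.e., the linear map V → V* induced by B has finite-dimensional range. -/
noncomputable section

/-- The range of a linear map is finite over the base ring if its kernel contains the kernel of a
linear map into a Noetherian module. -/
theorem LinearMap.finite_range_of_ker_le_ker {R V W N : Type*} [Ring R]
    [AddCommGroup V] [Module R V] [AddCommGroup W] [Module R W] [AddCommGroup N] [Module R N]
    [IsNoetherian R N] (f : V →ₗ[R] N) (g : V →ₗ[R] W)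
    (h : LinearMap.ker f ≤ LinearMap.ker g) : Module.Finite R (LinearMap.range g) := by
  have : Module.Finite R (V ⧸ LinearMap.ker f) :=
    Module.Finite.equiv f.quotKerEquivRange.symm
  have : Module.Finite R (V ⧸ LinearMap.ker g) :=
    Module.Finite.of_surjective (Submodule.factor h) (Submodule.factor_surjective h)
  exact Module.Finite.equiv g.quotKerEquivRange

/-- A vector acting by zero on a nontrivial Clifford module lies in the radical of the
polar form. -/
theorem CliffordAlgebra.polar_eq_zero_of_smul_eq_zero {K V M : Type*} [Field K]
    [AddCommGroup V] [Module K V] {Q : QuadraticForm K V} [AddCommGroup M]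
    [Module (CliffordAlgebra Q) M] [Module K M] [IsScalarTower K (CliffordAlgebra Q) M]
    [Nontrivial M] {v : V} (hv : ∀ m : M, CliffordAlgebra.ι Q v • m = 0) (w : V) :
    QuadraticMap.polar Q v w = 0 := by
  obtain ⟨m, hm⟩ := exists_ne (0 : M)
  have h := congrArg (· • m) (CliffordAlgebra.ι_mul_ι_add_swap (Q := Q) v w)
  simp only [add_smul, mul_smul, hv, smul_zero, add_zero, algebraMap_smul] at h
  exact (smul_eq_zero.mp h.symm).resolve_right hm

theorem finite_dimensional_module_implies_finite_rank_polar
    (V : Type*) [AddCommGroup V] [Module ℂ V] (Q : QuadraticForm ℂ V)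
    (M : Type*) [AddCommGroup M] [Module (CliffordAlgebra Q) M] [Module ℂ M]
    [IsScalarTower ℂ (CliffordAlgebra Q) M]
    [Nontrivial M] [FiniteDimensional ℂ M] :
    FiniteDimensional ℂ (LinearMap.range (QuadraticMap.polarBilin Q)) := by
  have := IsScalarTower.to_smulCommClass (R := ℂ) (A := CliffordAlgebra Q) (M := M)
  refine LinearMap.finite_range_of_ker_le_ker
    ((Algebra.lsmul ℂ ℂ M).toLinearMap ∘ₗ CliffordAlgebra.ι Q) _ fun v hv => ?_
  rw [LinearMap.mem_ker] at hv ⊢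
  ext w
  exact CliffordAlgebra.polar_eq_zero_of_smul_eq_zero (fun m => LinearMap.congr_fun hv m) w
end
end

section
/- Fix a decomposition n = i + j. For 1 ≤ k ≤ n and d ∈ ℤ/2ℤ, define u_k(d) ∈ Cl(Q) as the degree-d homogeneous component, with respect to the ℤ/2ℤ-grading of Cl(Q), of the element E_k := Σ_{1≤i_1<⋯<i_k≤n} (x_{i_1} + (−1)^{k+1} ξ_{i_1})(x_{i_2} + (−1)^{k} ξ_{i_2}) ⋯ (x_{i_{k−1}} − ξ_{i_{k−1}})(x_{i_k} + ξ_{i_k}) (the t-th factor from the left carries the sign (−1)^{k−t} in front of ξ_{i_t}); define u_a^+(e) by the same formula with all indices constrained to 1 ≤ i_1 < ⋯ < i_a ≤ i, and u_b^−(f) with all indices constrained to i+1 ≤ i_1 < ⋯ < i_b ≤ n, with the conventions u_0^±(0) = 1, u_0^±(1) = 0, and u_m^±(d) = 0 when m exceeds the number of available indices. Then for every k and every d ∈ ℤ/2ℤ: u_k(d) = Σ_{e+f=d in ℤ/2ℤ} Σ_{a+b=k, a,b≥0} (−1)^{e·b} u_a^+(e) · u_b^−(f), where e ∈ {0,1}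 is used as an integer in the sign (−1)^{e·b}. -/
open MvPolynomial Matrix

noncomputable section

/-- The quadratic form `Q` on the free module `R^n` (with `R = ℂ[x₁,…,xₙ]`) satisfying
`Q(eᵢ) = xᵢ` and whose polar form satisfies `B(eᵢ, eⱼ) = 0` for `i ≠ j`; thus in `Cl(Q)`
the elements `ξᵢ = ι(eᵢ)` satisfy `ξᵢ² = xᵢ` and `ξᵢξⱼ = -ξⱼξᵢ` for `i ≠ j`. -/
def Qform (n : ℕ) : QuadraticForm (MvPolynomial (Fin n) ℂ) (Fin n → MvPolynomial (Fin n) ℂ) :=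
  QuadraticMap.weightedSumSquares (MvPolynomial (Fin n) ℂ)
    (fun i : Fin n => (X i : MvPolynomial (Fin n) ℂ))

/-- For a subset `s = {i₁ < i₂ < ⋯}` of indices, the ordered product
`(x_{i₁} + (−1)^{k−1} ξ_{i₁})(x_{i₂} + (−1)^{k−2} ξ_{i₂}) ⋯ (x_{i_k} + ξ_{i_k})`:
the `t`-th factor from the left (`t` zero-based) carries the sign `(−1)^{k−1−t}`
in front of `ξ_{i_t}`. -/
def cliffFactors (n k : ℕ) (s : Finset (Fin n)) : CliffordAlgebra (Qform n) :=
  ((s.sort (· ≤ ·)).mapIdx fun t i =>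
    algebraMap (MvPolynomial (Fin n) ℂ) (CliffordAlgebra (Qform n)) (X i) +
      ((-1 : MvPolynomial (Fin n) ℂ) ^ (k - 1 - t)) •
        CliffordAlgebra.ι (Qform n) (Pi.single i 1)).prod

/-- `E_k = Σ_{1 ≤ i₁ < ⋯ < i_k ≤ n} (x_{i₁} + (−1)^{k+1} ξ_{i₁}) ⋯ (x_{i_k} + ξ_{i_k})`. -/
def Eelt (n k : ℕ) : CliffordAlgebra (Qform n) :=
  ∑ s ∈ Finset.univ.powersetCard k, cliffFactors n k s

/-- `u_k(d)`: the degree-`d` component of `E_k` with respect to the `ℤ/2ℤ`-grading of the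
Clifford algebra. -/
def uGen (n k : ℕ) (d : ZMod 2) : CliffordAlgebra (Qform n) :=
  (DirectSum.decompose (CliffordAlgebra.evenOdd (Qform n)) (Eelt n k) d :
    CliffordAlgebra (Qform n))

/-- `u_a⁺(e)`: same as `u_a(e)` but with all indices constrained to the first `i` variables. -/
def uPlus (n i a : ℕ) (e : ZMod 2) : CliffordAlgebra (Qform n) :=
  (DirectSum.decompose (CliffordAlgebra.evenOdd (Qform n))
      (∑ s ∈ (Finset.univ.filter fun j : Fin n => (j : ℕ) < i).powersetCard a,
        cliffFactors n a s) e :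
    CliffordAlgebra (Qform n))

/-- `u_b⁻(f)`: same as `u_b(f)` but with all indices constrained to the last `n − i`
variables. -/
def uMinus (n i b : ℕ) (f : ZMod 2) : CliffordAlgebra (Qform n) :=
  (DirectSum.decompose (CliffordAlgebra.evenOdd (Qform n))
      (∑ s ∈ (Finset.univ.filter fun j : Fin n => i ≤ (j : ℕ)).powersetCard b,
        cliffFactors n b s) f :
    CliffordAlgebra (Qform n))

theorem coe_decompose_mul_eq_sum {ι A σ : Type*} [Fintype ι] [DecidableEq ι] [AddCommGroup ι]
    [Ring A] [SetLike σ A] [AddSubgroupClass σ A] (𝒜 : ι → σ) [GradedRing 𝒜] (x y : A) (d : ι) :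
    (DirectSum.decompose 𝒜 (x * y) d : A) =
      ∑ e, (DirectSum.decompose 𝒜 x e : A) * DirectSum.decompose 𝒜 y (d - e) := by
  classical
  have hx : x = ∑ e, (DirectSum.decompose 𝒜 x e : A) := by
    conv_lhs => rw [← DirectSum.sum_support_decompose 𝒜 x]
    exact Finset.sum_subset (Finset.subset_univ _) fun e _ he => by
      simpa [DFinsupp.notMem_support_iff] using he
  conv_lhs => rw [hx, Finset.sum_mul, DirectSum.decompose_sum, DFinsupp.finsetSum_apply]
  rw [AddSubmonoidClass.coe_finsetSum]
  refine Finset.sum_congr rfl fun e _ => ?_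
  obtain ⟨f, rfl⟩ : ∃ f, d = e + f := ⟨d - e, by abel⟩
  rw [DirectSum.coe_decompose_mul_add_of_left_mem 𝒜 (SetLike.coe_mem _), add_sub_cancel_left]

namespace CliffordAlgebra

variable {R M : Type*} [CommRing R] [AddCommGroup M] [Module R M] {Q : QuadraticForm R M}

theorem involute_eq_neg_one_pow_mul {x : CliffordAlgebra Q} {e : ZMod 2} (h : x ∈ evenOdd Q e) :
    involute x = (-1) ^ e.val * x := by
  obtain rfl | rfl : e = 0 ∨ e = 1 := by clear h; revert e; decide
  · simpa using involute_eq_of_mem_even h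
  · simpa [ZMod.val_one] using involute_eq_of_mem_odd h

theorem involute_pow_eq_neg_one_pow_mul (b : ℕ) {x : CliffordAlgebra Q} {e : ZMod 2}
    (h : x ∈ evenOdd Q e) :
    ((involute : CliffordAlgebra Q →ₐ[R] _) ^ b) x = (-1) ^ (e.val * b) * x := by
  induction b with
  | zero => simp
  | succ b ih =>
    rw [pow_succ', AlgHom.mul_apply, ih, map_mul, map_pow, map_neg, map_one,
      involute_eq_neg_one_pow_mul h, ← mul_assoc, ← pow_add, Nat.mul_succ]

theorem involute_pow_ι (b : ℕ) (m : M) :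
    ((involute : CliffordAlgebra Q →ₐ[R] _) ^ b) (ι Q m) = (-1 : R) ^ b • ι Q m := by
  induction b with
  | zero => simp
  | succ b ih =>
    rw [pow_succ', AlgHom.mul_apply, ih, map_smul, involute_ι, pow_succ, mul_smul]
    simp

theorem decompose_involute_pow (b : ℕ) (x : CliffordAlgebra Q) (e : ZMod 2) :
    (DirectSum.decompose (evenOdd Q) (((involute : CliffordAlgebra Q →ₐ[R] _) ^ b) x) e :
      CliffordAlgebra Q) = (-1) ^ (e.val * b) * DirectSum.decompose (evenOdd Q) x e := by
  classical
  have hmem (f : ZMod 2) (y : CliffordAlgebra Q) (hy : y ∈ evenOdd Q f) :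
      ((involute : CliffordAlgebra Q →ₐ[R] _) ^ b) y ∈ evenOdd Q f := by
    rw [involute_pow_eq_neg_one_pow_mul b hy]
    rcases neg_one_pow_eq_or (CliffordAlgebra Q) (f.val * b) with h | h <;> simp [h, hy]
  rw [← involute_pow_eq_neg_one_pow_mul b (SetLike.coe_mem _)]
  induction x using DirectSum.Decomposition.inductionOn (evenOdd Q) with
  | zero => simp
  | @homogeneous f y =>
    by_cases hfe : f = e
    · subst hfe
      rw [DirectSum.decompose_of_mem_same _ (hmem f y y.2),
        DirectSum.decompose_of_mem_same _ y.2]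
    · rw [DirectSum.decompose_of_mem_ne _ (hmem f y y.2) hfe,
        DirectSum.decompose_of_mem_ne _ y.2 hfe, map_zero]
  | add x y hx hy =>
    simp only [map_add, DirectSum.decompose_add, DirectSum.add_apply, AddMemClass.coe_add, hx, hy]

end CliffordAlgebra

theorem Finset.sort_union_of_lt {α : Type*} [LinearOrder α] {s t : Finset α}
    (h : ∀ a ∈ s, ∀ b ∈ t, a < b) : (s ∪ t).sort = s.sort ++ t.sort := by
  have hd : Disjoint s t := Finset.disjoint_left.2 fun a ha hb => lt_irrefl a (h a ha a hb)
  refine List.Perm.eq_of_pairwise' (r := (· ≤ ·)) ?_ ?_ ?_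
  · exact Finset.pairwise_sort _ _
  · exact List.pairwise_append.2 ⟨Finset.pairwise_sort _ _, Finset.pairwise_sort _ _,
      fun a ha b hb => (h a (by simpa using ha) b (by simpa using hb)).le⟩
  · refine (List.perm_ext_iff_of_nodup (Finset.sort_nodup _ _) ?_).2 (by simp)
    exact List.nodup_append.2 ⟨Finset.sort_nodup _ _, Finset.sort_nodup _ _,
      fun a ha b hb => (h a (by simpa using ha) b (by simpa using hb)).ne⟩

theorem cliffFactors_union {n : ℕ} {s t : Finset (Fin n)} (h : ∀ a ∈ s, ∀ b ∈ t, a < b) :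
    cliffFactors n (s.card + t.card) (s ∪ t) =
      ((CliffordAlgebra.involute : CliffordAlgebra (Qform n) →ₐ[MvPolynomial (Fin n) ℂ] _) ^ t.card)
        (cliffFactors n s.card s) * cliffFactors n t.card t := by
  unfold cliffFactors
  rw [Finset.sort_union_of_lt h, List.mapIdx_append, List.prod_append, map_list_prod]
  congr 2
  · rw [List.mapIdx_eq_iff]
    intro m
    rw [List.getElem?_map, List.getElem?_mapIdx, Option.map_map]
    refine Option.map_congr fun j hj => ?_
    obtain ⟨hm, -⟩ := List.getElem?_eq_some_iff.1 (Option.mem_def.1 hj)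
    rw [Finset.length_sort] at hm
    simp only [Function.comp_apply, map_add, map_smul, AlgHom.commutes,
      CliffordAlgebra.involute_pow_ι, smul_smul, ← pow_add]
    congr 3
    omega
  · rw [List.mapIdx_eq_mapIdx_iff]
    intro m hm
    rw [Finset.length_sort]
    congr 3
    omega

theorem Finset.sum_powersetCard_disjUnion {α β : Type*} [DecidableEq α] [AddCommMonoid β]
    {s t : Finset α} (h : Disjoint s t) (k : ℕ) (f : Finset α → β) :
    ∑ u ∈ (s ∪ t).powersetCard k, f u =
      ∑ a ∈ Finset.range (k + 1), ∑ v ∈ s.powersetCard a, ∑ w ∈ t.powersetCard (k - a),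
        f (v ∪ w) := by
  simp_rw [← Finset.sum_product', Finset.sum_sigma']
  have hcard (u : Finset α) (hu : u ⊆ s ∪ t) : (u ∩ s).card + (u ∩ t).card = u.card := by
    rw [← Finset.card_union_of_disjoint
      (h.mono Finset.inter_subset_right Finset.inter_subset_right),
      ← Finset.inter_union_distrib_left, Finset.inter_eq_left.2 hu]
  refine Finset.sum_bij' (fun u _ => ⟨(u ∩ s).card, (u ∩ s, u ∩ t)⟩) (fun x _ => x.2.1 ∪ x.2.2)
    ?_ ?_ ?_ ?_ ?_
  · intro u hu
    rw [Finset.mem_powersetCard] at hu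
    have := hcard u hu.1
    simp only [Finset.mem_sigma, Finset.mem_range, Finset.mem_product, Finset.mem_powersetCard,
      Finset.inter_subset_right, true_and]
    omega
  · rintro ⟨a, v, w⟩ hx
    simp only [Finset.mem_sigma, Finset.mem_range, Finset.mem_product,
      Finset.mem_powersetCard] at hx ⊢
    obtain ⟨ha, ⟨hv, rfl⟩, hw, hwc⟩ := hx
    refine ⟨Finset.union_subset_union hv hw, ?_⟩
    rw [Finset.card_union_of_disjoint (h.mono hv hw)]
    omega
  · intro u hu
    rw [Finset.mem_powersetCard] at hu
    simp only [← Finset.inter_union_distrib_left, Finset.inter_eq_left.2 hu.1]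
  · rintro ⟨a, v, w⟩ hx
    simp only [Finset.mem_sigma, Finset.mem_range, Finset.mem_product,
      Finset.mem_powersetCard] at hx
    obtain ⟨ha, ⟨hv, rfl⟩, hw, hwc⟩ := hx
    have h1 : (v ∪ w) ∩ s = v := by
      rw [Finset.union_inter_distrib_right, Finset.inter_eq_left.2 hv,
        Finset.disjoint_iff_inter_eq_empty.1 (h.symm.mono_left hw), Finset.union_empty]
    have h2 : (v ∪ w) ∩ t = w := by
      rw [Finset.union_inter_distrib_right, Finset.inter_eq_left.2 hw,
        Finset.disjoint_iff_inter_eq_empty.1 (h.mono_left hv), Finset.empty_union]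
    simp only [h1, h2]
  · intro u hu
    rw [Finset.mem_powersetCard] at hu
    simp only [← Finset.inter_union_distrib_left, Finset.inter_eq_left.2 hu.1]

theorem u_decomposition (n i j : ℕ) (hn : 0 < n) (hij : i + j = n)
    (k : ℕ) (hk1 : 1 ≤ k) (hk2 : k ≤ n) (d : ZMod 2) :
    uGen n k d =
      ∑ e : ZMod 2, ∑ a ∈ Finset.range (k + 1),
        (-1 : CliffordAlgebra (Qform n)) ^ (e.val * (k - a)) *
          (uPlus n i a e * uMinus n i (k - a) (d - e)) := by
  have hE : Eelt n k = ∑ a ∈ Finset.range (k + 1),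
      ((CliffordAlgebra.involute :
        CliffordAlgebra (Qform n) →ₐ[MvPolynomial (Fin n) ℂ] _) ^ (k - a))
        (∑ s ∈ (Finset.univ.filter fun j : Fin n => (j : ℕ) < i).powersetCard a,
          cliffFactors n a s) *
        ∑ t ∈ (Finset.univ.filter fun j : Fin n => i ≤ (j : ℕ)).powersetCard (k - a),
          cliffFactors n (k - a) t := by
    have hun : (Finset.univ : Finset (Fin n)) =
        (Finset.univ.filter fun j : Fin n => (j : ℕ) < i) ∪
          (Finset.univ.filter fun j : Fin n => i ≤ (j : ℕ)) := by
      ext j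
      simp [lt_or_ge]
    have hdisj : Disjoint (Finset.univ.filter fun j : Fin n => (j : ℕ) < i)
        (Finset.univ.filter fun j : Fin n => i ≤ (j : ℕ)) :=
      Finset.disjoint_filter.2 fun j _ hj => not_le.2 hj
    rw [Eelt]
    conv_lhs => rw [hun]
    rw [Finset.sum_powersetCard_disjUnion hdisj]
    refine Finset.sum_congr rfl fun a ha => ?_
    rw [map_sum, Finset.sum_mul_sum]
    refine Finset.sum_congr rfl fun s hs => Finset.sum_congr rfl fun t ht => ?_
    rw [Finset.mem_powersetCard] at hs ht
    have hlt : ∀ p ∈ s, ∀ q ∈ t, p < q := fun p hp q hq =>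
      Fin.lt_def.2 (lt_of_lt_of_le (Finset.mem_filter.1 (hs.1 hp)).2
        (Finset.mem_filter.1 (ht.1 hq)).2)
    have hsum : s.card + t.card = k := by
      rw [Finset.mem_range] at ha
      omega
    have hun' := cliffFactors_union hlt
    rwa [hsum, hs.2, ht.2] at hun'
  rw [uGen, hE, DirectSum.decompose_sum, DFinsupp.finsetSum_apply,
    AddSubmonoidClass.coe_finsetSum, Finset.sum_comm]
  refine Finset.sum_congr rfl fun a _ => ?_
  rw [coe_decompose_mul_eq_sum]
  refine Finset.sum_congr rfl fun e _ => ?_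
  rw [CliffordAlgebra.decompose_involute_pow, mul_assoc, uPlus, uMinus]
end
end
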